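/- arXiv:2603.00038 — 10 statements merged into one kernel-verified Lean document; each statement's English description precedes it below -/
import Mathlib

section
/- Weak duality for the PT model: for every PT-TAP-feasible triple (q, p, π) and every PT-TVG-feasible pair (v, u) for the same goal price τ, the TAP objective is at most the TVG objective, i.e. τ * (∑_i q i + ∑_r p r) ≤ ∑_i v i * x i o − ∑_r u r * y r o. -/
open Finset

/-- Weak duality for the PT model: for every PT-TAP-feasible triple `(q, p, π)` and every
PT-TVG-feasible pair `(v, u)` for the same goal price `τ`, the TAP objective is at most the
TVG objective. -/
theorem pt_weak_duality
    {J I R : Type*} [Fintype J] [Fintype I] [Fintype R]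
    [Nonempty J] [Nonempty I] [Nonempty R]
    (x : I → J → ℝ) (y : R → J → ℝ)
    (hx : ∀ i j, 0 < x i j) (hy : ∀ r j, 0 < y r j)
    (o : J) (τ : ℝ) (hτ : 0 < τ)
    (q : I → ℝ) (p : R → ℝ) (π : J → ℝ)
    (hq : ∀ i, 0 ≤ q i) (hp : ∀ r, 0 ≤ p r) (hπ : ∀ j, 0 ≤ π j)
    (hqc : ∀ i, (∑ j, x i j * π j) + q i * x i o = x i o)
    (hpc : ∀ r, (∑ j, y r j * π j) - p r * y r o = y r o)
    (v : I → ℝ) (u : R → ℝ)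
    (hvu : ∀ j, (∑ i, v i * x i j) - (∑ r, u r * y r j) ≥ 0)
    (hv : ∀ i, x i o * v i ≥ τ) (hu : ∀ r, y r o * u r ≥ τ) :
    τ * ((∑ i, q i) + (∑ r, p r)) ≤ (∑ i, v i * x i o) - (∑ r, u r * y r o) := by
  have hX : ∑ i, v i * x i o =
      ∑ j, (∑ i, v i * x i j) * π j + ∑ i, q i * (x i o * v i) := by
    simp_rw [sum_mul]
    rw [sum_comm, ← sum_add_distrib]
    refine sum_congr rfl fun i _ => ?_
    simp_rw [mul_assoc, ← mul_sum]
    linear_combination -v i * hqc i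
  have hY : ∑ r, u r * y r o =
      ∑ j, (∑ r, u r * y r j) * π j - ∑ r, p r * (y r o * u r) := by
    simp_rw [sum_mul]
    rw [sum_comm, ← sum_sub_distrib]
    refine sum_congr rfl fun r _ => ?_
    simp_rw [mul_assoc, ← mul_sum]
    linear_combination -u r * hpc r
  have hπvu : ∑ j, (∑ r, u r * y r j) * π j ≤ ∑ j, (∑ i, v i * x i j) * π j :=
    sum_le_sum fun j _ => mul_le_mul_of_nonneg_right (sub_nonneg.mp (hvu j)) (hπ j)
  have hqv : (∑ i, q i) * τ ≤ ∑ i, q i * (x i o * v i) := by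
    rw [sum_mul]
    exact sum_le_sum fun i _ => mul_le_mul_of_nonneg_left (hv i) (hq i)
  have hpu : (∑ r, p r) * τ ≤ ∑ r, p r * (y r o * u r) := by
    rw [sum_mul]
    exact sum_le_sum fun r _ => mul_le_mul_of_nonneg_left (hu r) (hp r)
  rw [hX, hY]
  linarith
end

section
/- Strong duality for the PT model (Eq. (34), PT case): if there exists at least one PT-TAP-feasible triple and at least one PT-TVG-feasible pair for the goal price τ, then the supremum of the TAP objectives over all PT-TAP-feasible triples equals the infimum of the TVG objectives over all PT-TVG-feasible pairs. -/
open Finset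

/-- A triple `(q, p, π)` is PT-TAP-feasible. -/
def PTTAPFeasible {J I R : Type*} [Fintype J] [Fintype I] [Fintype R]
    (x : I → J → ℝ) (y : R → J → ℝ) (o : J)
    (q : I → ℝ) (p : R → ℝ) (π : J → ℝ) : Prop :=
  (∀ i, 0 ≤ q i) ∧ (∀ r, 0 ≤ p r) ∧ (∀ j, 0 ≤ π j) ∧
  (∀ i, (∑ j, x i j * π j) + q i * x i o = x i o) ∧
  (∀ r, (∑ j, y r j * π j) - p r * y r o = y r o)

/-- A pair `(v, u)` is PT-TVG-feasible for the goal price `τ`. -/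
def PTTVGFeasible {J I R : Type*} [Fintype J] [Fintype I] [Fintype R]
    (x : I → J → ℝ) (y : R → J → ℝ) (o : J) (τ : ℝ)
    (v : I → ℝ) (u : R → ℝ) : Prop :=
  (∀ j, (∑ i, v i * x i j) - (∑ r, u r * y r j) ≥ 0) ∧
  (∀ i, x i o * v i ≥ τ) ∧ (∀ r, y r o * u r ≥ τ)

theorem sum_div_mul {K : Type*} [Fintype K] (a b : K → ℝ) (m : ℝ) :
    ∑ k, a k / m * b k = (∑ k, b k * a k) / m := by
  rw [sum_div]
  exact sum_congr rfl fun k _ => by ring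

/-- **Gordan's theorem**: if the only nonnegative combination of the rows of `A` that vanishes is
the trivial one, then some functional is positive on every row. -/
theorem exists_forall_sum_mul_pos {ι κ : Type*} [Fintype ι] [Fintype κ] (A : ι → κ → ℝ)
    (h : ∀ w : ι → ℝ, (∀ i, 0 ≤ w i) → (∀ k, ∑ i, w i * A i k = 0) → ∀ i, w i = 0) :
    ∃ f : κ → ℝ, ∀ i, 0 < ∑ k, A i k * f k := by
  classical
  let L : (ι → ℝ) →ₗ[ℝ] (κ → ℝ) := Fintype.linearCombination ℝ A
  have hL (w k) : L w k = ∑ i, w i * A i k := by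
    simp [L, Fintype.linearCombination_apply]
  have hdisj : Disjoint ({0} : Set (κ → ℝ)) (L '' stdSimplex ℝ ι) := by
    rw [Set.disjoint_singleton_left]
    rintro ⟨w, ⟨hw, hw1⟩, hLw⟩
    have hw0 := h w hw fun k => by rw [← hL, hLw, Pi.zero_apply]
    simp [hw0] at hw1
  obtain ⟨f, a, b, ha, hab, hb⟩ := geometric_hahn_banach_compact_closed
    (convex_singleton 0) isCompact_singleton ((convex_stdSimplex ℝ ι).linear_image L)
    ((isCompact_stdSimplex ℝ ι).image L.continuous_of_finiteDimensional).isClosed hdisj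
  refine ⟨fun k => f (Pi.single k 1), fun i => ?_⟩
  have hi : b < f (A i) := hb _ ⟨Pi.single i 1, single_mem_stdSimplex ℝ i, by
    ext k; simp [hL, Pi.single_apply]⟩
  have h0 : 0 < a := by simpa using ha 0 rfl
  have hf := f.toLinearMap.pi_apply_eq_sum_univ (A i)
  simp only [ContinuousLinearMap.coe_coe, smul_eq_mul] at hf
  have hsingle (k : κ) : (fun j => if k = j then (1 : ℝ) else 0) = Pi.single k 1 := by
    ext j; simp [Pi.single_apply, eq_comm]
  simp only [hsingle] at hf
  linarith

section

variable {J I R : Type*} [Fintype J] [Fintype I] [Fintype R]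
  {x : I → J → ℝ} {y : R → J → ℝ} {o : J} {τ : ℝ}

/-- Weak duality for the PT model. -/
theorem PTTAPFeasible.objective_le {q : I → ℝ} {p : R → ℝ} {π : J → ℝ} {v : I → ℝ} {u : R → ℝ}
    (hP : PTTAPFeasible x y o q p π) (hD : PTTVGFeasible x y o τ v u) :
    τ * ((∑ i, q i) + ∑ r, p r) ≤ (∑ i, v i * x i o) - ∑ r, u r * y r o := by
  obtain ⟨hq, hp, hπ, hX, hY⟩ := hP
  obtain ⟨hj, hv, hu⟩ := hD
  have hq' : τ * ∑ i, q i ≤ ∑ i, v i * (q i * x i o) := by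
    rw [mul_sum]
    exact sum_le_sum fun i _ => by nlinarith [mul_le_mul_of_nonneg_left (hv i) (hq i)]
  have hp' : τ * ∑ r, p r ≤ ∑ r, u r * (p r * y r o) := by
    rw [mul_sum]
    exact sum_le_sum fun r _ => by nlinarith [mul_le_mul_of_nonneg_left (hu r) (hp r)]
  have hX' : ∑ i, v i * x i o
      = (∑ j, π j * ∑ i, v i * x i j) + ∑ i, v i * (q i * x i o) := by
    simp only [mul_sum]
    rw [sum_comm, ← sum_add_distrib]
    refine sum_congr rfl fun i _ => ?_
    conv_lhs => rw [← hX i]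
    rw [mul_add, mul_sum]
    exact congrArg (· + _) (sum_congr rfl fun j _ => by ring)
  have hY' : ∑ r, u r * y r o
      = (∑ j, π j * ∑ r, u r * y r j) - ∑ r, u r * (p r * y r o) := by
    simp only [mul_sum]
    rw [sum_comm, ← sum_sub_distrib]
    refine sum_congr rfl fun r _ => ?_
    conv_lhs => rw [← hY r]
    rw [mul_sub, mul_sum]
    exact congrArg (· - _) (sum_congr rfl fun j _ => by ring)
  have hπj : 0 ≤ ∑ j, π j * ((∑ i, v i * x i j) - ∑ r, u r * y r j) :=
    sum_nonneg fun j _ => mul_nonneg (hπ j) (hj j)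
  simp only [mul_sub, sum_sub_distrib] at hπj
  linarith

/-- The rows of the Gordan system attached to the PT model and a bound `c`. -/
def ptRow (x : I → J → ℝ) (y : R → J → ℝ) (o : J) (τ c : ℝ) [DecidableEq I] [DecidableEq R] :
    J ⊕ I ⊕ R ⊕ Unit ⊕ Unit → I ⊕ R ⊕ Unit → ℝ
  | .inl j => Sum.elim (fun i => x i j) (Sum.elim (fun r => y r j) 0)
  | .inr (.inl i) => Sum.elim (Pi.single i (x i o)) (Sum.elim 0 fun _ => τ)
  | .inr (.inr (.inl r)) => Sum.elim 0 (Sum.elim (Pi.single r (-y r o)) fun _ => τ)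
  | .inr (.inr (.inr (.inl _))) => Sum.elim 0 (Sum.elim 0 (-1))
  | .inr (.inr (.inr (.inr _))) =>
      Sum.elim (fun i => -x i o) (Sum.elim (fun r => -y r o) fun _ => -c)

/-- If every TAP objective is smaller than `c`, then some TVG objective is smaller than `c`. -/
theorem exists_ptTVGFeasible_lt [Nonempty I] (hx : ∀ i j, 0 < x i j) (hy : ∀ r j, 0 < y r j)
    {c : ℝ} (hc : ∀ q p π, PTTAPFeasible x y o q p π → τ * ((∑ i, q i) + ∑ r, p r) < c) :
    ∃ v u, PTTVGFeasible x y o τ v u ∧ (∑ i, v i * x i o) - ∑ r, u r * y r o < c := by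
  classical
  obtain ⟨f, hf⟩ := exists_forall_sum_mul_pos (ptRow x y o τ c) (by
    intro w hw hw0
    obtain ⟨π, hπ⟩ : ∃ π : J → ℝ, ∀ j, w (.inl j) = π j := ⟨_, fun _ => rfl⟩
    obtain ⟨q, hq⟩ : ∃ q : I → ℝ, ∀ i, w (.inr (.inl i)) = q i := ⟨_, fun _ => rfl⟩
    obtain ⟨p, hp⟩ : ∃ p : R → ℝ, ∀ r, w (.inr (.inr (.inl r))) = p r := ⟨_, fun _ => rfl⟩
    obtain ⟨s, hs⟩ : ∃ s, w (.inr (.inr (.inr (.inl ())))) = s := ⟨_, rfl⟩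
    obtain ⟨l, hl⟩ : ∃ l, w (.inr (.inr (.inr (.inr ())))) = l := ⟨_, rfl⟩
    have hX (i) := hw0 (.inl i)
    have hY (r) := hw0 (.inr (.inl r))
    have hZ := hw0 (.inr (.inr ()))
    simp only [Fintype.sum_sum_type, ptRow, hπ, hq, hp, hs, hl, Sum.elim_inl, Sum.elim_inr,
      Pi.single_apply, Pi.zero_apply, mul_ite, mul_zero, sum_const_zero, sum_ite_eq, mem_univ,
      if_true, univ_unique, sum_singleton, zero_add, PUnit.default_eq_unit,
      Pi.neg_apply, Pi.one_apply, ← sum_mul] at hX hY hZ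
    have hπ0 (j) : 0 ≤ π j := hπ j ▸ hw _
    have hq0 (i) : 0 ≤ q i := hq i ▸ hw _
    have hp0 (r) : 0 ≤ p r := hp r ▸ hw _
    have hs0 : 0 ≤ s := hs ▸ hw _
    have hl0 : 0 ≤ l := hl ▸ hw _
    obtain hlpos | rfl := hl0.lt_or_eq
    · have hcl := hc (fun i => q i / l) (fun r => p r / l) (fun j => π j / l)
        ⟨fun i => by have := hq0 i; positivity, fun r => by have := hp0 r; positivity,
          fun j => by have := hπ0 j; positivity, fun i => by
            have h : ∑ j, x i j * (π j / l) = (∑ j, π j * x i j) / l := by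
              rw [sum_div]; exact sum_congr rfl fun j _ => by ring
            rw [h]; field_simp; linarith [hX i], fun r => by
            have h : ∑ j, y r j * (π j / l) = (∑ j, π j * y r j) / l := by
              rw [sum_div]; exact sum_congr rfl fun j _ => by ring
            rw [h]; field_simp; linarith [hY r]⟩
      rw [← sum_div, ← sum_div, ← add_div, ← mul_div_assoc, div_lt_iff₀ hlpos] at hcl
      linarith
    · have hS (i) : 0 ≤ ∑ j, π j * x i j :=
        sum_nonneg fun j _ => mul_nonneg (hπ0 j) (hx i j).le
      have hπz (j) : π j = 0 := by
        obtain ⟨i⟩ := ‹Nonempty I›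
        have h : ∑ j, π j * x i j = 0 := by
          linarith [hX i, hS i, mul_nonneg (hq0 i) (hx i o).le]
        rw [sum_eq_zero_iff_of_nonneg fun j _ => mul_nonneg (hπ0 j) (hx i j).le] at h
        exact (mul_eq_zero.1 (h j (mem_univ j))).resolve_right (hx i j).ne'
      simp only [hπz, zero_mul, sum_const_zero, zero_add, add_zero] at hX hY
      have hqz (i) : q i = 0 := (mul_eq_zero.1 (hX i)).resolve_right (hx i o).ne'
      have hpz (r) : p r = 0 := by
        have := hY r
        simpa [(hy r o).ne'] using this
      simp only [hqz, hpz, sum_const_zero, zero_mul] at hZ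
      have hsz : s = 0 := by linarith
      rintro (j | i | r | ⟨⟩ | ⟨⟩)
      exacts [(hπ j).trans (hπz j), (hq i).trans (hqz i), (hp r).trans (hpz r), hs.trans hsz, hl])
  obtain ⟨v, hv⟩ : ∃ v : I → ℝ, ∀ i, f (.inl i) = v i := ⟨_, fun _ => rfl⟩
  obtain ⟨u, hu⟩ : ∃ u : R → ℝ, ∀ r, f (.inr (.inl r)) = -u r :=
    ⟨fun r => -f (.inr (.inl r)), fun r => (neg_neg _).symm⟩
  obtain ⟨m, hm⟩ : ∃ m, f (.inr (.inr ())) = -m := ⟨_, (neg_neg _).symm⟩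
  have hJ (j) := hf (.inl j)
  have hI (i) := hf (.inr (.inl i))
  have hR (r) := hf (.inr (.inr (.inl r)))
  have hS := hf (.inr (.inr (.inr (.inl ()))))
  have hC := hf (.inr (.inr (.inr (.inr ()))))
  simp only [Fintype.sum_sum_type, ptRow, hv, hu, hm, Sum.elim_inl, Sum.elim_inr,
    Pi.single_apply, Pi.zero_apply, ite_mul, zero_mul, sum_const_zero, sum_ite_eq', mem_univ,
    if_true, univ_unique, sum_singleton, zero_add, PUnit.default_eq_unit, add_zero, neg_zero,
    Pi.neg_apply, Pi.one_apply, mul_neg, neg_mul, neg_neg, one_mul, sum_neg_distrib]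
    at hJ hI hR hS hC
  refine ⟨fun i => v i / m, fun r => u r / m, ⟨fun j => ?_, fun i => ?_, fun r => ?_⟩, ?_⟩
  · rw [sum_div_mul, sum_div_mul, ← sub_div]
    exact div_nonneg (by linarith [hJ j]) hS.le
  · rw [ge_iff_le, ← mul_div_assoc, le_div_iff₀ hS]
    linarith [hI i]
  · rw [ge_iff_le, ← mul_div_assoc, le_div_iff₀ hS]
    linarith [hR r]
  · rw [sum_div_mul, sum_div_mul, ← sub_div, div_lt_iff₀ hS]
    linarith

end

/-- Strong duality for the PT model: if both programs are feasible, the supremum of the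
TAP objectives equals the infimum of the TVG objectives. -/
theorem pt_strong_duality
    {J I R : Type*} [Fintype J] [Fintype I] [Fintype R]
    [Nonempty J] [Nonempty I] [Nonempty R]
    (x : I → J → ℝ) (y : R → J → ℝ)
    (hx : ∀ i j, 0 < x i j) (hy : ∀ r j, 0 < y r j)
    (o : J) (τ : ℝ) (hτ : 0 < τ)
    (hTAP : ∃ q p π, PTTAPFeasible x y o q p π)
    (hTVG : ∃ v u, PTTVGFeasible x y o τ v u) :
    sSup {z : ℝ | ∃ q p π, PTTAPFeasible x y o q p π ∧
        z = τ * ((∑ i, q i) + (∑ r, p r))}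
      = sInf {z : ℝ | ∃ v u, PTTVGFeasible x y o τ v u ∧
        z = (∑ i, v i * x i o) - (∑ r, u r * y r o)} := by
  obtain ⟨q₀, p₀, π₀, hP₀⟩ := hTAP
  obtain ⟨v₀, u₀, hD₀⟩ := hTVG
  apply le_antisymm
  · refine csSup_le ⟨_, q₀, p₀, π₀, hP₀, rfl⟩ ?_
    rintro _ ⟨q, p, π, hP, rfl⟩
    refine le_csInf ⟨_, v₀, u₀, hD₀, rfl⟩ ?_
    rintro _ ⟨v, u, hD, rfl⟩
    exact hP.objective_le hD
  · refine le_of_forall_gt_imp_ge_of_dense fun c hc => ?_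
    have hbdd : BddAbove {z : ℝ | ∃ q p π, PTTAPFeasible x y o q p π ∧
        z = τ * ((∑ i, q i) + (∑ r, p r))} := by
      refine ⟨(∑ i, v₀ i * x i o) - ∑ r, u₀ r * y r o, ?_⟩
      rintro _ ⟨q, p, π, hP, rfl⟩
      exact hP.objective_le hD₀
    obtain ⟨v, u, hD, hlt⟩ := exists_ptTVGFeasible_lt (τ := τ) hx hy fun q p π hP =>
      (le_csSup hbdd ⟨q, p, π, hP, rfl⟩).trans_lt hc
    refine le_trans (csInf_le ?_ ⟨v, u, hD, rfl⟩) hlt.le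
    refine ⟨τ * ((∑ i, q₀ i) + ∑ r, p₀ r), ?_⟩
    rintro _ ⟨v, u, hD, rfl⟩
    exact hP₀.objective_le hD
end

section
/- Two-step normalization of the PT model (Eqs. (10)–(12)): suppose (v, u) is PT-TVG-feasible for the goal price τ = 1, let α = ∑_i v i * x i o and t̄ = 1/α. Then α ≥ 1 (so t̄ > 0), the scaled pair (t̄·v, t̄·u) is PT-TVG-feasible for the goal price t̄, its virtual input ∑_i t̄ * v i * x i o equals 1, its virtual output β = ∑_r t̄ * u r * y r o satisfies 0 < β ≤ 1, and its TVG objective 1 − β lies in the interval [0, 1). -/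
open Finset

lemma le_sum_of_forall_le {ι : Type*} [Fintype ι] [Nonempty ι] {τ : ℝ} (hτ : 0 ≤ τ)
    {f : ι → ℝ} (hf : ∀ i, τ ≤ f i) : τ ≤ ∑ i, f i :=
  (hf (Classical.arbitrary ι)).trans
    (single_le_sum (fun i _ => hτ.trans (hf i)) (mem_univ _))

lemma PTTVGFeasible.smul {J I R : Type*} [Fintype J] [Fintype I] [Fintype R]
    {x : I → J → ℝ} {y : R → J → ℝ} {o : J} {τ : ℝ} {v : I → ℝ} {u : R → ℝ}
    (h : PTTVGFeasible x y o τ v u) {t : ℝ} (ht : 0 ≤ t) :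
    PTTVGFeasible x y o (t * τ) (fun i => t * v i) (fun r => t * u r) := by
  obtain ⟨hj, hi, hr⟩ := h
  refine ⟨fun j => ?_, fun i => ?_, fun r => ?_⟩
  · simp only [mul_assoc, ← mul_sum, ← mul_sub]
    exact mul_nonneg ht (hj j)
  · rw [mul_left_comm]
    exact mul_le_mul_of_nonneg_left (hi i) ht
  · rw [mul_left_comm]
    exact mul_le_mul_of_nonneg_left (hr r) ht

/-- Two-step normalization of the PT model (Eqs. (10)–(12)): if `(v, u)` is PT-TVG-feasible
for the goal price `1`, `α = ∑ᵢ vᵢ xᵢₒ` and `t̄ = 1/α`, then `α ≥ 1` (so `t̄ > 0`),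
`(t̄·v, t̄·u)` is PT-TVG-feasible for the goal price `t̄`, its virtual input equals `1`,
its virtual output `β` satisfies `0 < β ≤ 1`, and its TVG objective `1 − β` lies in `[0, 1)`. -/
theorem pt_two_step_normalization
    {J I R : Type*} [Fintype J] [Fintype I] [Fintype R]
    [Nonempty J] [Nonempty I] [Nonempty R]
    (x : I → J → ℝ) (y : R → J → ℝ)
    (hx : ∀ i j, 0 < x i j) (hy : ∀ r j, 0 < y r j)
    (o : J)
    (v : I → ℝ) (u : R → ℝ)
    (hfeas : PTTVGFeasible x y o 1 v u)
    (α tbar β : ℝ)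
    (hα : α = ∑ i, v i * x i o)
    (ht : tbar = 1 / α)
    (hβ : β = ∑ r, tbar * u r * y r o) :
    1 ≤ α ∧ 0 < tbar ∧
    PTTVGFeasible x y o tbar (fun i => tbar * v i) (fun r => tbar * u r) ∧
    (∑ i, tbar * v i * x i o) = 1 ∧
    0 < β ∧ β ≤ 1 ∧
    0 ≤ 1 - β ∧ 1 - β < 1 := by
  have hα_ge : 1 ≤ α := by
    rw [hα]
    exact le_sum_of_forall_le zero_le_one fun i => by
      rw [mul_comm]
      exact hfeas.2.1 i
  have hout_ge : 1 ≤ ∑ r, u r * y r o :=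
    le_sum_of_forall_le zero_le_one fun r => by
      rw [mul_comm]
      exact hfeas.2.2 r
  have hα_pos : 0 < α := zero_lt_one.trans_le hα_ge
  have ht_pos : 0 < tbar := ht ▸ one_div_pos.mpr hα_pos
  have ht_mul : tbar * α = 1 := ht ▸ one_div_mul_cancel hα_pos.ne'
  have hβ_eq : β = tbar * ∑ r, u r * y r o := by
    simp only [hβ, mul_assoc, mul_sum]
  have hβ_pos : 0 < β := by
    rw [hβ_eq]
    exact mul_pos ht_pos (zero_lt_one.trans_le hout_ge)
  have hβ_le : β ≤ 1 := by
    rw [hβ_eq, ← ht_mul, hα]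
    exact mul_le_mul_of_nonneg_left (sub_nonneg.mp (hfeas.1 o)) ht_pos.le
  refine ⟨hα_ge, ht_pos, ?_, ?_, hβ_pos, hβ_le, sub_nonneg.mpr hβ_le, sub_lt_self 1 hβ_pos⟩
  · simpa only [mul_one] using hfeas.smul ht_pos.le
  · simp only [mul_assoc, ← mul_sum]
    rw [← hα, ht_mul]
end

section
/- The PT benchmark lies on the b-Efficiency Equator: if (q, p, π) is PT-TAP-feasible, (v, u) is PT-TVG-feasible for the same goal price τ, and their objectives are equal, then the benchmark point defined by x̂ i = ∑_j x i j * π j and ŷ r = ∑_j y r j * π j has zero virtual gap: ∑_i v i * x̂ i = ∑_r u r * ŷ r. -/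
open Finset

/-- The PT benchmark lies on the b-Efficiency Equator: if `(q, p, π)` is PT-TAP-feasible,
`(v, u)` is PT-TVG-feasible for the same goal price `τ`, and their objectives are equal,
then the benchmark point `x̂ i = ∑ⱼ x i j * π j`, `ŷ r = ∑ⱼ y r j * π j` has zero
virtual gap. -/
theorem pt_benchmark_on_equator
    {J I R : Type*} [Fintype J] [Fintype I] [Fintype R]
    [Nonempty J] [Nonempty I] [Nonempty R]
    (x : I → J → ℝ) (y : R → J → ℝ)
    (hx : ∀ i j, 0 < x i j) (hy : ∀ r j, 0 < y r j)
    (o : J) (τ : ℝ) (hτ : 0 < τ)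
    (q : I → ℝ) (p : R → ℝ) (π : J → ℝ)
    (hq : ∀ i, 0 ≤ q i) (hp : ∀ r, 0 ≤ p r) (hπ : ∀ j, 0 ≤ π j)
    (hqc : ∀ i, (∑ j, x i j * π j) + q i * x i o = x i o)
    (hpc : ∀ r, (∑ j, y r j * π j) - p r * y r o = y r o)
    (v : I → ℝ) (u : R → ℝ)
    (hvu : ∀ j, (∑ i, v i * x i j) - (∑ r, u r * y r j) ≥ 0)
    (hv : ∀ i, x i o * v i ≥ τ) (hu : ∀ r, y r o * u r ≥ τ)
    (heq : τ * ((∑ i, q i) + (∑ r, p r))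
        = (∑ i, v i * x i o) - (∑ r, u r * y r o)) :
    (∑ i, v i * (∑ j, x i j * π j)) = (∑ r, u r * (∑ j, y r j * π j)) := by
  apply le_antisymm
  · have input_le : ∑ i, v i * ∑ j, x i j * π j ≤ ∑ i, (v i * x i o - τ * q i) :=
      Finset.sum_le_sum fun i _ => by
        rw [eq_sub_of_add_eq (hqc i)]
        linarith [mul_le_mul_of_nonneg_left (hv i) (hq i)]
    have le_output : ∑ r, (u r * y r o + τ * p r) ≤ ∑ r, u r * ∑ j, y r j * π j :=
      Finset.sum_le_sum fun r _ => by
        rw [sub_eq_iff_eq_add.mp (hpc r)]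
        linarith [mul_le_mul_of_nonneg_left (hu r) (hp r)]
    rw [Finset.sum_sub_distrib, ← Finset.mul_sum] at input_le
    rw [Finset.sum_add_distrib, ← Finset.mul_sum] at le_output
    linarith
  · simp only [Finset.mul_sum]
    rw [Finset.sum_comm, Finset.sum_comm (s := (Finset.univ : Finset I))]
    refine Finset.sum_le_sum fun j _ => ?_
    simp only [← mul_assoc, ← Finset.sum_mul]
    exact mul_le_mul_of_nonneg_right (sub_nonneg.mp (hvu j)) (hπ j)
end

section
/- Return-to-virtual-scale is the reciprocal of efficiency (Eq. (45)): if (q, p, π) is PT-TAP-feasible, (v, u) is PT-TVG-feasible for the same goal price τ, their objectives are equal, and with benchmarks x̂ i = ∑_j x i j * π j, ŷ r = ∑_j y r j * π j one has ∑_i v i * x̂ i > 0, then the return-to-virtual-scale Ξ = ((∑_r u r * ŷ r)/(∑_r u r * y r o)) / ((∑_i v i * x̂ i)/(∑_i v i * x i o)) equals (∑_i v i * x i o)/(∑_r u r * y r o), i.e. the reciprocal of the efficiency score E = (∑_r u r * y r o)/(∑_i v i * x i o). -/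
open Finset

/-- Return-to-virtual-scale is the reciprocal of efficiency (Eq. (45)): under PT optimality
(equal primal and dual objectives) and positivity of the benchmark virtual input,
`Ξ = ((∑ᵣ uᵣ ŷᵣ)/(∑ᵣ uᵣ yᵣₒ)) / ((∑ᵢ vᵢ x̂ᵢ)/(∑ᵢ vᵢ xᵢₒ))` equals
`(∑ᵢ vᵢ xᵢₒ)/(∑ᵣ uᵣ yᵣₒ)`, the reciprocal of the efficiency score. -/
theorem pt_rtvs_reciprocal_of_efficiency
    {J I R : Type*} [Fintype J] [Fintype I] [Fintype R]
    [Nonempty J] [Nonempty I] [Nonempty R]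
    (x : I → J → ℝ) (y : R → J → ℝ)
    (hx : ∀ i j, 0 < x i j) (hy : ∀ r j, 0 < y r j)
    (o : J) (τ : ℝ) (hτ : 0 < τ)
    (q : I → ℝ) (p : R → ℝ) (π : J → ℝ)
    (hq : ∀ i, 0 ≤ q i) (hp : ∀ r, 0 ≤ p r) (hπ : ∀ j, 0 ≤ π j)
    (hqc : ∀ i, (∑ j, x i j * π j) + q i * x i o = x i o)
    (hpc : ∀ r, (∑ j, y r j * π j) - p r * y r o = y r o)
    (v : I → ℝ) (u : R → ℝ)
    (hvu : ∀ j, (∑ i, v i * x i j) - (∑ r, u r * y r j) ≥ 0)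
    (hv : ∀ i, x i o * v i ≥ τ) (hu : ∀ r, y r o * u r ≥ τ)
    (heq : τ * ((∑ i, q i) + (∑ r, p r))
        = (∑ i, v i * x i o) - (∑ r, u r * y r o))
    (hbench : 0 < ∑ i, v i * (∑ j, x i j * π j)) :
    ((∑ r, u r * (∑ j, y r j * π j)) / (∑ r, u r * y r o))
        / ((∑ i, v i * (∑ j, x i j * π j)) / (∑ i, v i * x i o))
      = (∑ i, v i * x i o) / (∑ r, u r * y r o) := by
  have virtual_output_le_input :
      ∑ r, u r * ∑ j, y r j * π j ≤ ∑ i, v i * ∑ j, x i j * π j := by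
    have swap_input : ∑ i, v i * ∑ j, x i j * π j = ∑ j, (∑ i, v i * x i j) * π j := by
      simp only [Finset.mul_sum, Finset.sum_mul, mul_assoc]
      exact Finset.sum_comm
    have swap_output : ∑ r, u r * ∑ j, y r j * π j = ∑ j, (∑ r, u r * y r j) * π j := by
      simp only [Finset.mul_sum, Finset.sum_mul, mul_assoc]
      exact Finset.sum_comm
    rw [swap_input, swap_output]
    exact Finset.sum_le_sum fun j _ =>
      mul_le_mul_of_nonneg_right (sub_nonneg.mp (hvu j)) (hπ j)
  have input_slack :
      ∑ i, v i * ∑ j, x i j * π j ≤ ∑ i, v i * x i o - τ * ∑ i, q i := by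
    rw [Finset.mul_sum, ← Finset.sum_sub_distrib]
    refine Finset.sum_le_sum fun i _ => ?_
    rw [eq_sub_of_add_eq (hqc i)]
    linarith [mul_le_mul_of_nonneg_right (hv i) (hq i)]
  have output_slack :
      ∑ r, u r * y r o + τ * ∑ r, p r ≤ ∑ r, u r * ∑ j, y r j * π j := by
    rw [Finset.mul_sum, ← Finset.sum_add_distrib]
    refine Finset.sum_le_sum fun r _ => ?_
    rw [sub_eq_iff_eq_add.mp (hpc r)]
    linarith [mul_le_mul_of_nonneg_right (hu r) (hp r)]
  have virtual_eq :
      ∑ r, u r * ∑ j, y r j * π j = ∑ i, v i * ∑ j, x i j * π j := by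
    linarith
  rw [virtual_eq, div_div_div_eq, mul_comm (∑ r, u r * y r o),
    mul_div_mul_left _ _ hbench.ne']
end

section
/- Weak duality for the bTSc model: for every real scalar κ, every bTSc-TAP-feasible triple (q, p, π) for κ, and every bTSc-TVG-feasible triple (v, u, w) for the same goal price τ, one has τ * (∑_i q i + ∑_r p r) ≤ ∑_i v i * x i o − ∑_r u r * y r o + κ * w. -/
open Finset

/-- Weak duality for the bTSc model: for every real scalar `κ`, every bTSc-TAP-feasible
triple `(q, p, π)` for `κ`, and every bTSc-TVG-feasible triple `(v, u, w)` for the same goal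
price `τ`, the TAP objective is at most the bTSc objective. -/
theorem btsc_weak_duality
    {J I R : Type*} [Fintype J] [Fintype I] [Fintype R]
    [Nonempty J] [Nonempty I] [Nonempty R]
    (x : I → J → ℝ) (y : R → J → ℝ)
    (hx : ∀ i j, 0 < x i j) (hy : ∀ r j, 0 < y r j)
    (o : J) (τ : ℝ) (hτ : 0 < τ) (κ : ℝ)
    (q : I → ℝ) (p : R → ℝ) (π : J → ℝ)
    (hq : ∀ i, 0 ≤ q i) (hp : ∀ r, 0 ≤ p r) (hπ : ∀ j, 0 ≤ π j)
    (hqc : ∀ i, (∑ j, x i j * π j) + q i * x i o = x i o)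
    (hpc : ∀ r, (∑ j, y r j * π j) - p r * y r o = y r o)
    (hκ : (∑ j, π j) = κ)
    (v : I → ℝ) (u : R → ℝ) (w : ℝ)
    (hvu : ∀ j, (∑ i, v i * x i j) - (∑ r, u r * y r j) + w ≥ 0)
    (hv : ∀ i, x i o * v i ≥ τ) (hu : ∀ r, y r o * u r ≥ τ) :
    τ * ((∑ i, q i) + (∑ r, p r))
      ≤ (∑ i, v i * x i o) - (∑ r, u r * y r o) + κ * w := by
  have hin : ∑ i, v i * x i o =
      ∑ j, π j * ∑ i, v i * x i j + ∑ i, q i * (x i o * v i) := by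
    simp_rw [mul_sum]
    rw [sum_comm, ← sum_add_distrib]
    refine sum_congr rfl fun i _ => ?_
    have h : ∑ j, π j * (v i * x i j) = v i * ∑ j, x i j * π j := by
      rw [mul_sum]
      exact sum_congr rfl fun j _ => by ring
    rw [h]
    linear_combination -v i * hqc i
  have hout : ∑ r, u r * y r o =
      ∑ j, π j * ∑ r, u r * y r j - ∑ r, p r * (y r o * u r) := by
    simp_rw [mul_sum]
    rw [sum_comm, ← sum_sub_distrib]
    refine sum_congr rfl fun r _ => ?_
    have h : ∑ j, π j * (u r * y r j) = u r * ∑ j, y r j * π j := by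
      rw [mul_sum]
      exact sum_congr rfl fun j _ => by ring
    rw [h]
    linear_combination -u r * hpc r
  have hslack : 0 ≤ ∑ j, π j * ((∑ i, v i * x i j) - (∑ r, u r * y r j) + w) :=
    sum_nonneg fun j _ => mul_nonneg (hπ j) (hvu j)
  simp only [mul_add, mul_sub, sum_add_distrib, sum_sub_distrib, ← sum_mul, hκ] at hslack
  have hqτ : τ * ∑ i, q i ≤ ∑ i, q i * (x i o * v i) := by
    rw [mul_comm, sum_mul]
    exact sum_le_sum fun i _ => mul_le_mul_of_nonneg_left (hv i) (hq i)
  have hpτ : τ * ∑ r, p r ≤ ∑ r, p r * (y r o * u r) := by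
    rw [mul_comm, sum_mul]
    exact sum_le_sum fun r _ => mul_le_mul_of_nonneg_left (hu r) (hp r)
  linarith
end

section
/- Nonnegative virtual gap and bTSc efficiency at most one (Eqs. (28) and (31)): if there exists at least one bTSc-TAP-feasible triple for the scalar κ, then every bTSc-TVG-feasible triple (v, u, w) for the goal price τ satisfies ∑_i v i * x i o − ∑_r u r * y r o + κ * w ≥ 0; consequently, for every γ ∈ ℝ the affected virtual output ∑_r u r * y r o − γ * κ * w is at most the affected virtual input ∑_i v i * x i o + (1 − γ) * κ * w, so whenever the latter is strictly positive the bTSc efficiency score (∑_r u r * y r o − γ κ w)/(∑_i v i * x i o + (1 − γ) κ w) is at most 1. -/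
open Finset

/-- A triple `(q, p, π)` is bTSc-TAP-feasible for the scalar `κ`. -/
def BTScTAPFeasible {J I R : Type*} [Fintype J] [Fintype I] [Fintype R]
    (x : I → J → ℝ) (y : R → J → ℝ) (o : J) (κ : ℝ)
    (q : I → ℝ) (p : R → ℝ) (π : J → ℝ) : Prop :=
  (∀ i, 0 ≤ q i) ∧ (∀ r, 0 ≤ p r) ∧ (∀ j, 0 ≤ π j) ∧
  (∀ i, (∑ j, x i j * π j) + q i * x i o = x i o) ∧
  (∀ r, (∑ j, y r j * π j) - p r * y r o = y r o) ∧
  (∑ j, π j) = κ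

/-- A triple `(v, u, w)` is bTSc-TVG-feasible for the goal price `τ`. -/
def BTScTVGFeasible {J I R : Type*} [Fintype J] [Fintype I] [Fintype R]
    (x : I → J → ℝ) (y : R → J → ℝ) (o : J) (τ : ℝ)
    (v : I → ℝ) (u : R → ℝ) (w : ℝ) : Prop :=
  (∀ j, (∑ i, v i * x i j) - (∑ r, u r * y r j) + w ≥ 0) ∧
  (∀ i, x i o * v i ≥ τ) ∧ (∀ r, y r o * u r ≥ τ)

/-- Nonnegative virtual gap and bTSc efficiency at most one (Eqs. (28) and (31)): if there
exists a bTSc-TAP-feasible triple for `κ`, then every bTSc-TVG-feasible triple `(v, u, w)`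
has nonnegative virtual gap; consequently the affected virtual output is at most the affected
virtual input, and the bTSc efficiency score is at most 1 whenever the affected virtual input
is strictly positive. -/
theorem btsc_gap_nonneg_and_efficiency_le_one
    {J I R : Type*} [Fintype J] [Fintype I] [Fintype R]
    [Nonempty J] [Nonempty I] [Nonempty R]
    (x : I → J → ℝ) (y : R → J → ℝ)
    (hx : ∀ i j, 0 < x i j) (hy : ∀ r j, 0 < y r j)
    (o : J) (τ : ℝ) (hτ : 0 < τ) (κ : ℝ)
    (hTAP : ∃ q p π, BTScTAPFeasible x y o κ q p π) :
    ∀ v u w, BTScTVGFeasible x y o τ v u w →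
      ((∑ i, v i * x i o) - (∑ r, u r * y r o) + κ * w ≥ 0 ∧
       (∀ γ : ℝ,
         ((∑ r, u r * y r o) - γ * κ * w ≤ (∑ i, v i * x i o) + (1 - γ) * κ * w) ∧
         (0 < (∑ i, v i * x i o) + (1 - γ) * κ * w →
           ((∑ r, u r * y r o) - γ * κ * w)
             / ((∑ i, v i * x i o) + (1 - γ) * κ * w) ≤ 1))) := by
  obtain ⟨q, p, π, hq, hp, hπ, hin, hout, hsum⟩ := hTAP
  rintro v u w ⟨hgap, hv, hu⟩
  have hv_nonneg (i) : 0 ≤ v i :=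
    (pos_of_mul_pos_right (hτ.trans_le (hv i)) (hx i o).le).le
  have hu_nonneg (r) : 0 ≤ u r :=
    (pos_of_mul_pos_right (hτ.trans_le (hu r)) (hy r o).le).le
  have hinput : ∑ i, v i * ∑ j, x i j * π j ≤ ∑ i, v i * x i o := by
    refine sum_le_sum fun i _ => mul_le_mul_of_nonneg_left ?_ (hv_nonneg i)
    linarith [hin i, mul_nonneg (hq i) (hx i o).le]
  have houtput : ∑ r, u r * y r o ≤ ∑ r, u r * ∑ j, y r j * π j := by
    refine sum_le_sum fun r _ => mul_le_mul_of_nonneg_left ?_ (hu_nonneg r)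
    linarith [hout r, mul_nonneg (hp r) (hy r o).le]
  have hweighted : 0 ≤ ∑ j, ((∑ i, v i * x i j) - (∑ r, u r * y r j) + w) * π j :=
    sum_nonneg fun j _ => mul_nonneg (hgap j) (hπ j)
  have hexpand : ∑ j, ((∑ i, v i * x i j) - (∑ r, u r * y r j) + w) * π j =
      (∑ i, v i * ∑ j, x i j * π j) - (∑ r, u r * ∑ j, y r j * π j) + κ * w := by
    simp only [← hsum, add_mul, sub_mul, sum_add_distrib, sum_sub_distrib, sum_mul, mul_sum,
      mul_assoc]
    rw [sum_comm, sum_comm (f := fun j r => u r * (y r j * π j))]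
    simp only [mul_comm w]
  have hnonneg : (∑ i, v i * x i o) - (∑ r, u r * y r o) + κ * w ≥ 0 := by
    linarith
  have hle (γ : ℝ) :
      (∑ r, u r * y r o) - γ * κ * w ≤ (∑ i, v i * x i o) + (1 - γ) * κ * w := by
    linarith
  exact ⟨hnonneg, fun γ => ⟨hle γ, fun hpos => (div_le_one hpos).2 (hle γ)⟩⟩
end

section
/- Complementary slackness for the bTSc model (Eqs. (38) and (39)): if (q, p, π) is bTSc-TAP-feasible for κ, (v, u, w) is bTSc-TVG-feasible for the same goal price τ, and their objectives are equal, i.e. τ * (∑_i q i + ∑_r p r) = ∑_i v i * x i o − ∑_r u r * y r o + κ * w, then for every j ∈ J one has π j * (∑_i v i * x i j − ∑_r u r * y r j + w) = 0, for every i one has q i * (x i o * v i − τ) = 0, and for every r one has p r * (y r o * u r − τ) = 0. -/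
open Finset

/-- Complementary slackness for the bTSc model (Eqs. (38) and (39)): if `(q, p, π)` is
bTSc-TAP-feasible for `κ`, `(v, u, w)` is bTSc-TVG-feasible for the same goal price `τ`,
and their objectives are equal, then the complementary slackness conditions hold. -/
theorem btsc_complementary_slackness
    {J I R : Type*} [Fintype J] [Fintype I] [Fintype R]
    [Nonempty J] [Nonempty I] [Nonempty R]
    (x : I → J → ℝ) (y : R → J → ℝ)
    (hx : ∀ i j, 0 < x i j) (hy : ∀ r j, 0 < y r j)
    (o : J) (τ : ℝ) (hτ : 0 < τ) (κ : ℝ)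
    (q : I → ℝ) (p : R → ℝ) (π : J → ℝ)
    (hq : ∀ i, 0 ≤ q i) (hp : ∀ r, 0 ≤ p r) (hπ : ∀ j, 0 ≤ π j)
    (hqc : ∀ i, (∑ j, x i j * π j) + q i * x i o = x i o)
    (hpc : ∀ r, (∑ j, y r j * π j) - p r * y r o = y r o)
    (hκ : (∑ j, π j) = κ)
    (v : I → ℝ) (u : R → ℝ) (w : ℝ)
    (hvu : ∀ j, (∑ i, v i * x i j) - (∑ r, u r * y r j) + w ≥ 0)
    (hv : ∀ i, x i o * v i ≥ τ) (hu : ∀ r, y r o * u r ≥ τ)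
    (heq : τ * ((∑ i, q i) + (∑ r, p r))
        = (∑ i, v i * x i o) - (∑ r, u r * y r o) + κ * w) :
    (∀ j, π j * ((∑ i, v i * x i j) - (∑ r, u r * y r j) + w) = 0) ∧
    (∀ i, q i * (x i o * v i - τ) = 0) ∧
    (∀ r, p r * (y r o * u r - τ) = 0) := by
  have hX : ∑ j, π j * ∑ i, v i * x i j = ∑ i, (v i * x i o - q i * (x i o * v i)) := by
    simp_rw [Finset.mul_sum]
    rw [Finset.sum_comm]
    refine Finset.sum_congr rfl fun i _ => ?_
    calc ∑ j, π j * (v i * x i j) = v i * ∑ j, x i j * π j := by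
          rw [Finset.mul_sum]
          exact Finset.sum_congr rfl fun j _ => by ring
      _ = v i * x i o - q i * (x i o * v i) := by linear_combination v i * hqc i
  have hY : ∑ j, π j * ∑ r, u r * y r j = ∑ r, (u r * y r o + p r * (y r o * u r)) := by
    simp_rw [Finset.mul_sum]
    rw [Finset.sum_comm]
    refine Finset.sum_congr rfl fun r _ => ?_
    calc ∑ j, π j * (u r * y r j) = u r * ∑ j, y r j * π j := by
          rw [Finset.mul_sum]
          exact Finset.sum_congr rfl fun j _ => by ring
      _ = u r * y r o + p r * (y r o * u r) := by linear_combination u r * hpc r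
  have hJ (j : J) : 0 ≤ π j * ((∑ i, v i * x i j) - (∑ r, u r * y r j) + w) :=
    mul_nonneg (hπ j) (hvu j)
  have hI (i : I) : 0 ≤ q i * (x i o * v i - τ) := mul_nonneg (hq i) (sub_nonneg.2 (hv i))
  have hR (r : R) : 0 ≤ p r * (y r o * u r - τ) := mul_nonneg (hp r) (sub_nonneg.2 (hu r))
  have hJs := Finset.sum_nonneg fun j (_ : j ∈ Finset.univ) => hJ j
  have hIs := Finset.sum_nonneg fun i (_ : i ∈ Finset.univ) => hI i
  have hRs := Finset.sum_nonneg fun r (_ : r ∈ Finset.univ) => hR r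
  have hsum : (∑ j, π j * ((∑ i, v i * x i j) - (∑ r, u r * y r j) + w))
      + (∑ i, q i * (x i o * v i - τ)) + (∑ r, p r * (y r o * u r - τ)) = 0 := by
    simp only [mul_add, mul_sub, Finset.sum_add_distrib, Finset.sum_sub_distrib,
      ← Finset.sum_mul] at hX hY heq ⊢
    rw [hX, hY, hκ]
    linear_combination -heq
  refine ⟨fun j => ?_, fun i => ?_, fun r => ?_⟩
  · exact (Finset.sum_eq_zero_iff_of_nonneg fun j _ => hJ j).1 (by linarith) j (Finset.mem_univ j)
  · exact (Finset.sum_eq_zero_iff_of_nonneg fun i _ => hI i).1 (by linarith) i (Finset.mem_univ i)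
  · exact (Finset.sum_eq_zero_iff_of_nonneg fun r _ => hR r).1 (by linarith) r (Finset.mem_univ r)
end

section
/- The bTSc benchmark has zero virtual gap: if (q, p, π) is bTSc-TAP-feasible for κ, (v, u, w) is bTSc-TVG-feasible for the same goal price τ, and their objectives are equal, then the benchmark point defined by x̂ i = ∑_j x i j * π j and ŷ r = ∑_j y r j * π j satisfies ∑_i v i * x̂ i − ∑_r u r * ŷ r + κ * w = 0. -/
open Finset

/-- The bTSc benchmark has zero virtual gap: if `(q, p, π)` is bTSc-TAP-feasible for `κ`,
`(v, u, w)` is bTSc-TVG-feasible for the same goal price `τ`, and their objectives are equal,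
then the benchmark point `x̂ i = ∑ⱼ x i j * π j`, `ŷ r = ∑ⱼ y r j * π j` satisfies
`∑ᵢ vᵢ x̂ᵢ − ∑ᵣ uᵣ ŷᵣ + κ w = 0`. -/
theorem btsc_benchmark_zero_gap
    {J I R : Type*} [Fintype J] [Fintype I] [Fintype R]
    [Nonempty J] [Nonempty I] [Nonempty R]
    (x : I → J → ℝ) (y : R → J → ℝ)
    (hx : ∀ i j, 0 < x i j) (hy : ∀ r j, 0 < y r j)
    (o : J) (τ : ℝ) (hτ : 0 < τ) (κ : ℝ)
    (q : I → ℝ) (p : R → ℝ) (π : J → ℝ)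
    (hq : ∀ i, 0 ≤ q i) (hp : ∀ r, 0 ≤ p r) (hπ : ∀ j, 0 ≤ π j)
    (hqc : ∀ i, (∑ j, x i j * π j) + q i * x i o = x i o)
    (hpc : ∀ r, (∑ j, y r j * π j) - p r * y r o = y r o)
    (hκ : (∑ j, π j) = κ)
    (v : I → ℝ) (u : R → ℝ) (w : ℝ)
    (hvu : ∀ j, (∑ i, v i * x i j) - (∑ r, u r * y r j) + w ≥ 0)
    (hv : ∀ i, x i o * v i ≥ τ) (hu : ∀ r, y r o * u r ≥ τ)
    (heq : τ * ((∑ i, q i) + (∑ r, p r))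
        = (∑ i, v i * x i o) - (∑ r, u r * y r o) + κ * w) :
    (∑ i, v i * (∑ j, x i j * π j)) - (∑ r, u r * (∑ j, y r j * π j)) + κ * w = 0 := by
  have gap_eq : (∑ i, v i * (∑ j, x i j * π j)) - (∑ r, u r * (∑ j, y r j * π j)) + κ * w
      = ∑ j, π j * ((∑ i, v i * x i j) - (∑ r, u r * y r j) + w) := by
    simp only [mul_add, mul_sub, sum_add_distrib, sum_sub_distrib, mul_sum, ← hκ, sum_mul]
    rw [sum_comm (s := (univ : Finset I)), sum_comm (s := (univ : Finset R))]
    congr 2 <;> refine sum_congr rfl fun j _ => sum_congr rfl fun _ _ => by ring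
  have gap_nonneg : 0 ≤ ∑ j, π j * ((∑ i, v i * x i j) - (∑ r, u r * y r j) + w) :=
    sum_nonneg fun j _ => mul_nonneg (hπ j) (hvu j)
  have input_le : (∑ i, v i * (∑ j, x i j * π j)) ≤ (∑ i, v i * x i o) - τ * ∑ i, q i := by
    rw [mul_sum, ← sum_sub_distrib]
    refine sum_le_sum fun i _ => ?_
    rw [eq_sub_of_add_eq (hqc i)]
    linarith [mul_le_mul_of_nonneg_right (hv i) (hq i)]
  have le_output : (∑ r, u r * y r o) + τ * ∑ r, p r ≤ ∑ r, u r * (∑ j, y r j * π j) := by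
    rw [mul_sum, ← sum_add_distrib]
    refine sum_le_sum fun r _ => ?_
    rw [eq_add_of_sub_eq (hpc r)]
    linarith [mul_le_mul_of_nonneg_right (hu r) (hp r)]
  linarith
end

section
/- Efficient DMUs have super-efficiency at least one (Eq. (66)): suppose there exists a PT-TVG-feasible pair (v₀, u₀) for the goal price τ with zero virtual gap, i.e. ∑_i v₀ i * x i o = ∑_r u₀ r * y r o. Then (v₀, u₀) is sPT-TVG-feasible for τ with sPT objective 0; consequently, any (v⋆, u⋆) that maximizes the sPT-TVG objective over all sPT-TVG-feasible pairs satisfies ∑_r u⋆ r * y r o ≥ ∑_i v⋆ i * x i o > 0, so its super-efficiency score E = (∑_r u⋆ r * y r o)/(∑_i v⋆ i * x i o) satisfies E ≥ 1. -/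
open Finset

/-- A pair `(v, u)` is sPT-TVG-feasible for the goal price `τ`. -/
def SPTTVGFeasible {J I R : Type*} [Fintype J] [Fintype I] [Fintype R]
    (x : I → J → ℝ) (y : R → J → ℝ) (o : J) (τ : ℝ)
    (v : I → ℝ) (u : R → ℝ) : Prop :=
  (∀ j, j ≠ o → (∑ i, v i * x i j) - (∑ r, u r * y r j) ≥ 0) ∧
  (∀ i, x i o * v i ≥ τ) ∧ (∀ r, y r o * u r ≥ τ)

/-- Efficient DMUs have super-efficiency at least one (Eq. (66)): if `(v₀, u₀)` is
PT-TVG-feasible for `τ` with zero virtual gap, then it is sPT-TVG-feasible with sPT objective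
`0`, and every maximizer `(v⋆, u⋆)` of the sPT-TVG objective satisfies
`∑ᵣ u⋆ᵣ yᵣₒ ≥ ∑ᵢ v⋆ᵢ xᵢₒ > 0`, so its super-efficiency score is at least `1`. -/
theorem spt_super_efficiency_ge_one
    {J I R : Type*} [Fintype J] [Fintype I] [Fintype R]
    [Nonempty J] [Nonempty I] [Nonempty R]
    (x : I → J → ℝ) (y : R → J → ℝ)
    (hx : ∀ i j, 0 < x i j) (hy : ∀ r j, 0 < y r j)
    (o : J) (τ : ℝ) (hτ : 0 < τ)
    (v₀ : I → ℝ) (u₀ : R → ℝ)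
    (hfeas₀ : PTTVGFeasible x y o τ v₀ u₀)
    (hzero : (∑ i, v₀ i * x i o) = (∑ r, u₀ r * y r o)) :
    (SPTTVGFeasible x y o τ v₀ u₀ ∧
      (∑ r, u₀ r * y r o) - (∑ i, v₀ i * x i o) = 0) ∧
    (∀ (vs : I → ℝ) (us : R → ℝ),
      SPTTVGFeasible x y o τ vs us →
      (∀ (v : I → ℝ) (u : R → ℝ), SPTTVGFeasible x y o τ v u →
        (∑ r, u r * y r o) - (∑ i, v i * x i o)
          ≤ (∑ r, us r * y r o) - (∑ i, vs i * x i o)) →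
      ((∑ i, vs i * x i o) ≤ (∑ r, us r * y r o) ∧
       0 < (∑ i, vs i * x i o) ∧
       1 ≤ (∑ r, us r * y r o) / (∑ i, vs i * x i o))) := by
  have hs : SPTTVGFeasible x y o τ v₀ u₀ := ⟨fun j _ => hfeas₀.1 j, hfeas₀.2⟩
  refine ⟨⟨hs, by linarith⟩, fun vs us hfeas hmax => ?_⟩
  have hle : ∑ i, vs i * x i o ≤ ∑ r, us r * y r o := by linarith [hmax v₀ u₀ hs]
  have hpos : 0 < ∑ i, vs i * x i o :=
    Finset.sum_pos (fun i _ => by linarith [hfeas.2.1 i, mul_comm (vs i) (x i o)])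
      Finset.univ_nonempty
  exact ⟨hle, hpos, (one_le_div hpos).2 hle⟩
end
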